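/- Let 0 < ε ≤ 1/3 and let G = K^c_{n,n} be an edge-colored complete balanced bipartite graph with δ^c(G) ≥ (2/3 + ε)n and n ≥ 6/ε. Then for every vertex u of G and every integer l with 3 ≤ l ≤ (2/3)ε n, there exists a properly colored cycle of length 2l containing u. -/

import Mathlib

open SimpleGraph

/-- Vertex type of `K_{n,n}`: left part `X`, right part `Y`. -/
abbrev V2 (n : ℕ) := Fin n ⊕ Fin n

/-- The complete balanced bipartite graph `K_{n,n}`. -/
def KBB (n : ℕ) : SimpleGraph (V2 n) := completeBipartiteGraph (Fin n) (Fin n)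

/-- The color degree of a vertex: the number of distinct colors on its incident edges. -/
def colorDeg (n : ℕ) (c : V2 n → V2 n → ℕ) : V2 n → ℕ
  | Sum.inl x => ((Finset.univ : Finset (Fin n)).image fun j => c (Sum.inl x) (Sum.inr j)).card
  | Sum.inr y => ((Finset.univ : Finset (Fin n)).image fun i => c (Sum.inr y) (Sum.inl i)).card

/-- The minimum color degree `δ^c`. -/
noncomputable def minColorDeg (n : ℕ) (c : V2 n → V2 n → ℕ) : ℕ :=
  ⨅ v : V2 n, colorDeg n c v

/-- `Δ_mon(v)`: the maximum number of same-colored edges incident to `v`. -/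
def monDeg (n : ℕ) (c : V2 n → V2 n → ℕ) : V2 n → ℕ
  | Sum.inl x => Finset.univ.sup fun j : Fin n =>
      (Finset.univ.filter fun j' : Fin n =>
        c (Sum.inl x) (Sum.inr j') = c (Sum.inl x) (Sum.inr j)).card
  | Sum.inr y => Finset.univ.sup fun i : Fin n =>
      (Finset.univ.filter fun i' : Fin n =>
        c (Sum.inr y) (Sum.inl i') = c (Sum.inr y) (Sum.inl i)).card

/-- A subgraph is properly colored: adjacent edges receive distinct colors. -/
def IsPCSubgraph (n : ℕ) (c : V2 n → V2 n → ℕ) (H : SimpleGraph (V2 n)) : Prop :=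
  ∀ u v w, H.Adj u v → H.Adj u w → v ≠ w → c u v ≠ c u w

/-- Every cycle of `H` has length at least `t`. -/
def CyclesAtLeast {n : ℕ} (H : SimpleGraph (V2 n)) (t : ℕ) : Prop :=
  ∀ (v : V2 n) (p : H.Walk v v), p.IsCycle → t ≤ p.length

/-- A properly colored 2-factor of `K_{n,n}`: a spanning 2-regular properly colored
subgraph. -/
def IsPC2Factor (n : ℕ) (c : V2 n → V2 n → ℕ) (H : SimpleGraph (V2 n)) : Prop :=
  H ≤ KBB n ∧ (∀ v, (H.neighborSet v).ncard = 2) ∧ IsPCSubgraph n c H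

/-- A properly colored `2^{(t)}`-factor of the induced subgraph on `S`. -/
def IsPC2FactorOn (n : ℕ) (c : V2 n → V2 n → ℕ) (S : Set (V2 n))
    (H : SimpleGraph (V2 n)) (t : ℕ) : Prop :=
  H ≤ KBB n ∧ (∀ u v, H.Adj u v → u ∈ S) ∧ (∀ v ∈ S, (H.neighborSet v).ncard = 2) ∧
    IsPCSubgraph n c H ∧ CyclesAtLeast H t

/-- A properly colored cycle of length `k` in `K_{n,n}`, given as an injective cyclic
sequence of vertices with adjacent edges having distinct colors. -/
def IsPCCycle (n : ℕ) (c : V2 n → V2 n → ℕ) (k : ℕ) (f : ZMod k → V2 n) : Prop :=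
  Function.Injective f ∧ (∀ i, (KBB n).Adj (f i) (f (i + 1))) ∧
    ∀ i, c (f i) (f (i + 1)) ≠ c (f (i + 1)) (f (i + 2))

/-- Consecutive edges of the vertex list receive distinct colors. -/
def PCL (n : ℕ) (c : V2 n → V2 n → ℕ) : List (V2 n) → Prop
  | a :: b :: d :: rest => c a b ≠ c b d ∧ PCL n c (b :: d :: rest)
  | _ => True

/-- A properly colored path in `K_{n,n}` given by its list of vertices. -/
def IsPCPath (n : ℕ) (c : V2 n → V2 n → ℕ) (l : List (V2 n)) : Prop :=
  l ≠ [] ∧ l.Nodup ∧ l.Chain' (KBB n).Adj ∧ PCL n c l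

/-- A properly colored odd path: odd number of edges, i.e. an even number of vertices,
equivalently one endpoint in each part. -/
def IsPCOddPath (n : ℕ) (c : V2 n → V2 n → ℕ) (l : List (V2 n)) : Prop :=
  IsPCPath n c l ∧ Even l.length

/-- A properly colored 3-path `x' y' x'' y''` with `x', x'' ∈ X` and `y', y'' ∈ Y`,
encoded as the quadruple `(x', y', x'', y'')`. -/
def IsPC3Path (n : ℕ) (c : V2 n → V2 n → ℕ) : Fin n × Fin n × Fin n × Fin n → Prop
  | (a, b, a', b') =>
    a ≠ a' ∧ b ≠ b' ∧
      c (Sum.inl a) (Sum.inr b) ≠ c (Sum.inr b) (Sum.inl a') ∧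
      c (Sum.inr b) (Sum.inl a') ≠ c (Sum.inl a') (Sum.inr b')

/-- An absorbing path `x' y' x'' y''` for the pair `(x, y)`: a PC 3-path avoiding
`{x, y}` such that `x' y' x y x'' y''` is a properly colored path. -/
def IsAbsorbingPath1 (n : ℕ) (c : V2 n → V2 n → ℕ) (x y : Fin n) :
    Fin n × Fin n × Fin n × Fin n → Prop
  | (a, b, a', b') =>
    IsPC3Path n c (a, b, a', b') ∧
      a ≠ x ∧ a' ≠ x ∧ b ≠ y ∧ b' ≠ y ∧
      c (Sum.inl a) (Sum.inr b) ≠ c (Sum.inr b) (Sum.inl x) ∧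
      c (Sum.inr b) (Sum.inl x) ≠ c (Sum.inl x) (Sum.inr y) ∧
      c (Sum.inl x) (Sum.inr y) ≠ c (Sum.inr y) (Sum.inl a') ∧
      c (Sum.inr y) (Sum.inl a') ≠ c (Sum.inl a') (Sum.inr b')

/-- An absorbing path `x' y' x'' y''` for the quadruple `(x₁, y₁; x₂, y₂)`: a PC 3-path
avoiding `{x₁, y₁, x₂, y₂}` such that the paths `x' y' x₁ y₁` and `y'' x'' y₂ x₂`
are properly colored. -/
def IsAbsorbingPath2 (n : ℕ) (c : V2 n → V2 n → ℕ) (x₁ y₁ x₂ y₂ : Fin n) :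
    Fin n × Fin n × Fin n × Fin n → Prop
  | (a, b, a', b') =>
    IsPC3Path n c (a, b, a', b') ∧
      a ≠ x₁ ∧ a ≠ x₂ ∧ a' ≠ x₁ ∧ a' ≠ x₂ ∧ b ≠ y₁ ∧ b ≠ y₂ ∧ b' ≠ y₁ ∧ b' ≠ y₂ ∧
      c (Sum.inl a) (Sum.inr b) ≠ c (Sum.inr b) (Sum.inl x₁) ∧
      c (Sum.inr b) (Sum.inl x₁) ≠ c (Sum.inl x₁) (Sum.inr y₁) ∧
      c (Sum.inr b') (Sum.inl a') ≠ c (Sum.inl a') (Sum.inr y₂) ∧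
      c (Sum.inl a') (Sum.inr y₂) ≠ c (Sum.inr y₂) (Sum.inl x₂)

/-- Two 3-paths (as quadruples) are vertex-disjoint. -/
def QuadDisjoint {n : ℕ} (P Q : Fin n × Fin n × Fin n × Fin n) : Prop :=
  P.1 ≠ Q.1 ∧ P.1 ≠ Q.2.2.1 ∧ P.2.2.1 ≠ Q.1 ∧ P.2.2.1 ≠ Q.2.2.1 ∧
    P.2.1 ≠ Q.2.1 ∧ P.2.1 ≠ Q.2.2.2 ∧ P.2.2.2 ≠ Q.2.1 ∧ P.2.2.2 ≠ Q.2.2.2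

/-- A `1^{(t)}`-path-cycle: a vertex-disjoint union of exactly one PC path and a
(possibly empty) collection of PC cycles, each cycle of length at least `t`. -/
structure OnePathCycleT (n : ℕ) (c : V2 n → V2 n → ℕ) (t : ℕ) where
  path : List (V2 n)
  path_pc : IsPCPath n c path
  numCycles : ℕ
  cycLen : Fin numCycles → ℕ
  cyc : (i : Fin numCycles) → ZMod (cycLen i) → V2 n
  cyc_pc : ∀ i, IsPCCycle n c (cycLen i) (cyc i)
  cyc_long : ∀ i, t ≤ cycLen i
  disj_path_cyc : ∀ i j, cyc i j ∉ path
  disj_cyc_cyc : ∀ i i', i ≠ i' → ∀ j j', cyc i j ≠ cyc i' j'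

/-- The vertex set of a `1^{(t)}`-path-cycle. -/
def OnePathCycleT.verts {n : ℕ} {c : V2 n → V2 n → ℕ} {t : ℕ}
    (H : OnePathCycleT n c t) : Set (V2 n) :=
  {v | v ∈ H.path} ∪ ⋃ i, Set.range (H.cyc i)

theorem KBB_adj_iff {n : ℕ} (v w : V2 n) : (KBB n).Adj v w ↔ w.isLeft = !v.isLeft := by
  cases v <;> cases w <;> simp [KBB]

open Classical in
theorem card_KBB_neighbors (n : ℕ) (v : V2 n) :
    (Finset.univ.filter fun w => (KBB n).Adj v w).card = n := by
  cases v with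
  | inl x =>
    have h : (Finset.univ.filter fun w => (KBB n).Adj (Sum.inl x) w) =
        Finset.univ.map ⟨Sum.inr, Sum.inr_injective⟩ := by
      ext (w | w) <;> simp [KBB]
    rw [h, Finset.card_map, Finset.card_univ, Fintype.card_fin]
  | inr y =>
    have h : (Finset.univ.filter fun w => (KBB n).Adj (Sum.inr y) w) =
        Finset.univ.map ⟨Sum.inl, Sum.inl_injective⟩ := by
      ext (w | w) <;> simp [KBB]
    rw [h, Finset.card_map, Finset.card_univ, Fintype.card_fin]

/-- If a function on an `n`-element type takes the value `α` often, it has few values. -/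
theorem card_fiber_add_card_image_le {ι : Type*} [Fintype ι] (g : ι → ℕ) (α : ℕ) :
    (Finset.univ.filter fun j => g j = α).card + (Finset.univ.image g).card
      ≤ Fintype.card ι + 1 := by
  classical
  have hsub : Finset.univ.image g ⊆
      insert α ((Finset.univ.filter fun j => ¬ g j = α).image g) := by
    intro b hb
    obtain ⟨j, -, rfl⟩ := Finset.mem_image.1 hb
    by_cases h : g j = α
    · simp [h]
    · exact Finset.mem_insert_of_mem (Finset.mem_image_of_mem _ (by simp [h]))
  have h1 := (Finset.card_le_card hsub).trans (Finset.card_insert_le _ _)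
  have h2 := Finset.card_image_le (s := Finset.univ.filter fun j => ¬ g j = α) (f := g)
  have h3 := Finset.card_filter_add_card_filter_not (s := (Finset.univ : Finset ι))
    (fun j => g j = α)
  rw [Finset.card_univ] at h3
  omega

open Classical in
theorem card_color_class_add_colorDeg_le (n : ℕ) (c : V2 n → V2 n → ℕ) (v : V2 n) (α : ℕ) :
    (Finset.univ.filter fun w => (KBB n).Adj v w ∧ c v w = α).card + colorDeg n c v
      ≤ n + 1 := by
  have key : ∀ (e : Fin n ↪ V2 n), (∀ w, (KBB n).Adj v w → ∃ j, e j = w) →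
      (Finset.univ.filter fun w => (KBB n).Adj v w ∧ c v w = α).card
        + (Finset.univ.image fun j => c v (e j)).card ≤ n + 1 := by
    intro e he
    have h := card_fiber_add_card_image_le (fun j => c v (e j)) α
    have hsub : (Finset.univ.filter fun w => (KBB n).Adj v w ∧ c v w = α) ⊆
        (Finset.univ.filter fun j => c v (e j) = α).map e := by
      intro w hw
      obtain ⟨hadj, hc⟩ := (Finset.mem_filter.1 hw).2
      obtain ⟨j, rfl⟩ := he w hadj
      exact Finset.mem_map_of_mem e (by simpa using hc)
    have h' := Finset.card_le_card hsub
    rw [Finset.card_map] at h'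
    rw [Fintype.card_fin] at h
    omega
  cases v with
  | inl x => exact key ⟨Sum.inr, Sum.inr_injective⟩ (by
      rintro (w | w) hw
      · simp [KBB] at hw
      · exact ⟨w, rfl⟩)
  | inr y => exact key ⟨Sum.inl, Sum.inl_injective⟩ (by
      rintro (w | w) hw
      · exact ⟨w, rfl⟩
      · simp [KBB] at hw)

/-- If each of two relations is sparse on one side, some pair avoids both. -/
theorem exists_pair_avoiding {α β : Type*} (A : Finset α) (B : Finset β) (k : ℕ)
    (hA : 2 * k < A.card) (hB : 2 * k < B.card) (R S : α → β → Prop)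
    [∀ a b, Decidable (R a b)] [∀ a b, Decidable (S a b)]
    (hR : ∀ a ∈ A, (B.filter fun b => R a b).card ≤ k)
    (hS : ∀ b ∈ B, (A.filter fun a => S a b).card ≤ k) :
    ∃ a ∈ A, ∃ b ∈ B, ¬ R a b ∧ ¬ S a b := by
  by_contra! hcon
  have h1 : A.card * B.card ≤
      ∑ a ∈ A, ∑ b ∈ B, ((if R a b then 1 else 0) + (if S a b then 1 else 0)) := by
    rw [← smul_eq_mul, ← Finset.sum_const]
    refine Finset.sum_le_sum fun a ha => ?_
    rw [Finset.card_eq_sum_ones]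
    refine Finset.sum_le_sum fun b hb => ?_
    by_cases h : R a b
    · simp [h]
    · simp [hcon a ha b hb h]
  simp only [Finset.sum_add_distrib] at h1
  rw [Finset.sum_comm (f := fun a b => if S a b then 1 else 0)] at h1
  simp only [← Finset.card_filter] at h1
  have h2 := Finset.sum_le_card_nsmul A _ k hR
  have h3 := Finset.sum_le_card_nsmul B _ k hS
  simp only [smul_eq_mul] at h2 h3
  nlinarith [Nat.mul_le_mul_left A.card hB, Nat.mul_le_mul_right B.card hA]

/-- The vertices `f 0, …, f m` form a properly colored path. -/
structure IsPCSeq (n : ℕ) (c : V2 n → V2 n → ℕ) (f : ℕ → V2 n) (m : ℕ) : Prop where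
  inj : ∀ i j, i ≤ m → j ≤ m → f i = f j → i = j
  adj : ∀ i, i + 1 ≤ m → (KBB n).Adj (f i) (f (i + 1))
  color_ne : ∀ i, i + 2 ≤ m → c (f i) (f (i + 1)) ≠ c (f (i + 1)) (f (i + 2))

namespace IsPCSeq

variable {n : ℕ} {c : V2 n → V2 n → ℕ} {f : ℕ → V2 n} {m : ℕ}

theorem extend (h : IsPCSeq n c f m) {w : V2 n} (hw : ∀ i ≤ m, w ≠ f i)
    (hadj : (KBB n).Adj (f m) w) (hc : c (f m) w ≠ c (f (m - 1)) (f m)) :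
    IsPCSeq n c (Function.update f (m + 1) w) (m + 1) := by
  have hold : ∀ i ≤ m, Function.update f (m + 1) w i = f i := fun i hi =>
    Function.update_of_ne (by omega) _ _
  have hnew : Function.update f (m + 1) w (m + 1) = w := Function.update_self _ _ _
  refine ⟨fun i j hi hj hij => ?_, fun i hi => ?_, fun i hi => ?_⟩
  · rcases Nat.le_succ_iff.1 hi with hi | rfl <;> rcases Nat.le_succ_iff.1 hj with hj | rfl
    · rw [hold i hi, hold j hj] at hij
      exact h.inj i j hi hj hij
    · rw [hold i hi, hnew] at hij
      exact absurd hij.symm (hw i hi)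
    · rw [hold j hj, hnew] at hij
      exact absurd hij (hw j hj)
    · rfl
  · rcases Nat.le_succ_iff.1 hi with hi | hi
    · rw [hold i (by omega), hold (i + 1) hi]
      exact h.adj i hi
    · obtain rfl : i = m := by omega
      rwa [hold i le_rfl, hnew]
  · rcases Nat.le_succ_iff.1 hi with hi | hi
    · rw [hold i (by omega), hold (i + 1) (by omega), hold (i + 2) hi]
      exact h.color_ne i hi
    · obtain rfl : m = i + 1 := by omega
      rw [hold i (by omega), hold (i + 1) le_rfl, hnew]
      exact hc.symm

theorem isLeft_even (h : IsPCSeq n c f m) :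
    ∀ i, 2 * i ≤ m → (f (2 * i)).isLeft = (f 0).isLeft := by
  intro i
  induction i with
  | zero => simp
  | succ i ih =>
    intro hi
    have h1 := (KBB_adj_iff _ _).1 (h.adj (2 * i) (by omega))
    have h2 := (KBB_adj_iff _ _).1 (h.adj (2 * i + 1) (by omega))
    rw [show 2 * (i + 1) = 2 * i + 1 + 1 by ring, h2, h1, ih (by omega), Bool.not_not]

theorem isPCCycle (h : IsPCSeq n c f (m + 1)) (hm : 1 ≤ m) (hadj : (KBB n).Adj (f (m + 1)) (f 0))
    (hc : c (f m) (f (m + 1)) ≠ c (f (m + 1)) (f 0))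
    (hc' : c (f (m + 1)) (f 0) ≠ c (f 0) (f 1)) :
    IsPCCycle n c (m + 2) fun i => f i.val := by
  have hval : ∀ i : ZMod (m + 2), i.val ≤ m + 1 := fun i => Nat.lt_succ_iff.1 (ZMod.val_lt i)
  have hone : (1 : ZMod (m + 2)).val = 1 := ZMod.val_one'' (by omega)
  have hlt : ∀ i : ZMod (m + 2), i.val ≤ m → (i + 1).val = i.val + 1 := fun i hi => by
    rw [ZMod.val_add, hone, Nat.mod_eq_of_lt (by omega)]
  have heq : ∀ i : ZMod (m + 2), i.val = m + 1 → (i + 1).val = 0 := fun i hi => by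
    rw [ZMod.val_add, hone, hi, Nat.mod_self]
  refine ⟨fun i j hij => ZMod.val_injective _ (h.inj _ _ (hval i) (hval j) hij),
    fun i => ?_, fun i => ?_⟩
  · rcases Nat.le_succ_iff.1 (hval i) with hi | hi
    · simpa only [hlt i hi] using h.adj i.val (by omega)
    · simpa only [heq i hi, hi] using hadj
  · rw [show i + 2 = i + 1 + 1 by ring]
    rcases Nat.le_succ_iff.1 (hval i) with hi | hi
    · have hi1 := hlt i hi
      rcases Nat.le_succ_iff.1 (hval (i + 1)) with hj | hj
      · simpa only [hlt _ hj, hi1] using h.color_ne i.val (by omega)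
      · have hm' : i.val = m := by omega
        simpa only [heq _ hj, hi1, hm'] using hc
    · have hi1 := heq i hi
      simpa only [hlt (i + 1) (by omega), hi1, hi] using hc'

end IsPCSeq

section

variable {n : ℕ} {c : V2 n → V2 n → ℕ} {k : ℕ}

open Classical in
theorem lt_card_available
    (hk : ∀ v α, (Finset.univ.filter fun w => (KBB n).Adj v w ∧ c v w = α).card ≤ k)
    {m : ℕ} (hn : 3 * k + m + 1 < n) (f : ℕ → V2 n) (v : V2 n) (α : ℕ) :
    2 * k < (Finset.univ.filter fun w =>
      (KBB n).Adj v w ∧ c v w ≠ α ∧ ∀ i ≤ m, w ≠ f i).card := by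
  have hcover : (Finset.univ.filter fun w => (KBB n).Adj v w) ⊆
      ((Finset.univ.filter fun w => (KBB n).Adj v w ∧ c v w = α) ∪
        (Finset.range (m + 1)).image f) ∪
      (Finset.univ.filter fun w => (KBB n).Adj v w ∧ c v w ≠ α ∧ ∀ i ≤ m, w ≠ f i) := by
    intro w hw
    have hadj := (Finset.mem_filter.1 hw).2
    by_cases hα : c v w = α
    · simp [hadj, hα]
    · by_cases hf : ∃ i ≤ m, w = f i
      · obtain ⟨i, hi, rfl⟩ := hf
        exact Finset.mem_union_left _ (Finset.mem_union_right _
          (Finset.mem_image_of_mem f (Finset.mem_range.2 (by omega))))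
      · push Not at hf
        exact Finset.mem_union_right _ (Finset.mem_filter.2 ⟨Finset.mem_univ _, hadj, hα, hf⟩)
  have h1 := Finset.card_le_card hcover
  rw [card_KBB_neighbors] at h1
  have h2 := h1.trans ((Finset.card_union_le _ _).trans
    (Nat.add_le_add_right (Finset.card_union_le _ _) _))
  have h3 := (Finset.card_image_le (s := Finset.range (m + 1)) (f := f))
  rw [Finset.card_range] at h3
  have h4 := hk v α
  omega

open Classical in
theorem exists_isPCSeq
    (hk : ∀ v α, (Finset.univ.filter fun w => (KBB n).Adj v w ∧ c v w = α).card ≤ k)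
    (u : V2 n) (m : ℕ) (hn : 3 * k + m < n) : ∃ f, f 0 = u ∧ IsPCSeq n c f m := by
  induction m with
  | zero => exact ⟨fun _ => u, rfl, by omega, by omega, by omega⟩
  | succ m ih =>
    obtain ⟨f, hf0, hf⟩ := ih (by omega)
    obtain ⟨w, hw⟩ := Finset.card_pos.1 ((Nat.zero_le _).trans_lt
      (lt_card_available hk hn f (f m) (c (f (m - 1)) (f m))))
    obtain ⟨-, hadj, hc, hne⟩ := Finset.mem_filter.1 hw
    exact ⟨_, by rw [Function.update_of_ne (by omega), hf0], hf.extend hne hadj hc⟩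

open Classical in
/-- If every color class at every vertex has at most `k` edges and `n` is large compared to
`3 * k`, every vertex lies on a properly colored cycle of length `2 * p + 4`. -/
theorem exists_isPCCycle_of_color_class_le (hsym : ∀ u v, c u v = c v u)
    (hk : ∀ v α, (Finset.univ.filter fun w => (KBB n).Adj v w ∧ c v w = α).card ≤ k)
    (u : V2 n) (p : ℕ) (hn : 3 * k + (2 * p + 1) + 1 < n) :
    ∃ f : ZMod (2 * p + 4) → V2 n, IsPCCycle n c (2 * p + 4) f ∧ ∃ i, f i = u := by
  obtain ⟨f, hf0, hf⟩ := exists_isPCSeq hk u (2 * p + 1) (by omega)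
  have hsub : ∀ v α (T : Finset (V2 n)), (∀ w ∈ T, (KBB n).Adj v w) →
      (T.filter fun w => c v w = α).card ≤ k := fun v α T hT =>
    (Finset.card_le_card fun w hw => by
      simp only [Finset.mem_filter, Finset.mem_univ, true_and] at hw ⊢
      exact ⟨hT w hw.1, hw.2⟩).trans (hk v α)
  have hab : (f (2 * p + 1)).isLeft = !(f 0).isLeft := by
    rw [(KBB_adj_iff _ _).1 (hf.adj (2 * p) le_rfl), hf.isLeft_even p (by omega)]
  obtain ⟨y, hy, x, hx, hyx, hxy⟩ := exists_pair_avoiding _ _ k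
    (lt_card_available hk hn f (f (2 * p + 1)) (c (f (2 * p + 1 - 1)) (f (2 * p + 1))))
    (lt_card_available hk hn f (f 0) (c (f 0) (f 1)))
    (fun y x => c y x = c (f (2 * p + 1)) y) (fun y x => c x y = c x (f 0))
    (fun y hy => hsub y _ _ fun x hx => by
      have h1 := (KBB_adj_iff _ _).1 (Finset.mem_filter.1 hx).2.1
      have h2 := (KBB_adj_iff _ _).1 (Finset.mem_filter.1 hy).2.1
      rw [KBB_adj_iff, h1, h2, hab, Bool.not_not])
    (fun x hx => hsub x _ _ fun y hy => by
      have h1 := (KBB_adj_iff _ _).1 (Finset.mem_filter.1 hy).2.1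
      have h2 := (KBB_adj_iff _ _).1 (Finset.mem_filter.1 hx).2.1
      rw [KBB_adj_iff, h1, h2, hab])
  obtain ⟨-, hay, hcay, hyf⟩ := Finset.mem_filter.1 hy
  obtain ⟨-, hbx, hcbx, hxf⟩ := Finset.mem_filter.1 hx
  have hadj : (KBB n).Adj y x := by
    rw [KBB_adj_iff, (KBB_adj_iff _ _).1 hbx, (KBB_adj_iff _ _).1 hay, hab, Bool.not_not]
  have hg := hf.extend hyf hay hcay
  set g := Function.update f (2 * p + 1 + 1) y
  have hgy : g (2 * p + 1 + 1) = y := Function.update_self _ _ _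
  have hgf : ∀ i ≤ 2 * p + 1, g i = f i := fun i hi => Function.update_of_ne (by omega) _ _
  have hxg : ∀ i ≤ 2 * p + 1 + 1, x ≠ g i := by
    intro i hi
    rcases Nat.le_succ_iff.1 hi with hi | rfl
    · rw [hgf i hi]
      exact hxf i hi
    · rw [hgy]
      exact hadj.ne.symm
  have hG := hg.extend hxg (by rwa [hgy]) (by
    rw [hgy, Nat.add_sub_cancel, hgf _ le_rfl]
    exact hyx)
  have hGx : Function.update g (2 * p + 1 + 1 + 1) x (2 * p + 1 + 1 + 1) = x :=
    Function.update_self _ _ _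
  have hGg : ∀ i ≤ 2 * p + 1 + 1, Function.update g (2 * p + 1 + 1 + 1) x i = g i :=
    fun i hi => Function.update_of_ne (by omega) _ _
  refine ⟨_, hG.isPCCycle (by omega) ?_ ?_ ?_, 0, ?_⟩
  · rw [hGx, hGg 0 (by omega), hgf 0 (by omega)]
    exact hbx.symm
  · rw [hGx, hGg 0 (by omega), hgf 0 (by omega), hGg _ le_rfl, hgy, hsym y x]
    exact hxy
  · rw [hGx, hGg 0 (by omega), hgf 0 (by omega), hGg 1 (by omega), hgf 1 (by omega), hsym x]
    exact hcbx
  · rw [ZMod.val_zero, hGg 0 (by omega), hgf 0 (by omega), hf0]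

end

/-- the short even cycles step in the proof of Theorem 1.5.  If
`0 < ε ≤ 1/3`, `δ^c(K_{n,n}) ≥ (2/3 + ε)n` and `n ≥ 6/ε`, then every vertex lies on a
PC cycle of length `2l` for every `3 ≤ l ≤ (2/3)εn`. -/
theorem short_even_pc_cycles (n : ℕ) (ε : ℝ) (hε : 0 < ε) (hε' : ε ≤ 1 / 3)
    (c : V2 n → V2 n → ℕ) (hsym : ∀ u v, c u v = c v u)
    (hdeg : ∀ v, ((2 : ℝ) / 3 + ε) * n ≤ (colorDeg n c v : ℝ))
    (hn : (6 : ℝ) / ε ≤ (n : ℝ)) :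
    ∀ u : V2 n, ∀ l : ℕ, 3 ≤ l → (l : ℝ) ≤ 2 / 3 * ε * n →
      ∃ f : ZMod (2 * l) → V2 n, IsPCCycle n c (2 * l) f ∧ ∃ i, f i = u := by
  intro u l hl hl'
  classical
  obtain ⟨p, rfl⟩ : ∃ p, l = p + 2 := ⟨l - 2, by omega⟩
  set d := ⌈((2 : ℝ) / 3 + ε) * n⌉₊
  have hdv : ∀ v, d ≤ colorDeg n c v := fun v => Nat.ceil_le.2 (hdeg v)
  have hdle : ((2 : ℝ) / 3 + ε) * n ≤ d := Nat.le_ceil _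
  have h6 : 6 ≤ n * ε := (div_le_iff₀ hε).1 hn
  have h3d : 2 * n + 2 * (p + 2) + 2 ≤ 3 * d := by
    have : (2 * n + 2 * (p + 2) + 2 : ℝ) ≤ 3 * d := by
      push_cast at hl'
      nlinarith
    exact_mod_cast this
  have hcls := fun v α => card_color_class_add_colorDeg_le n c v α
  refine exists_isPCCycle_of_color_class_le (k := n + 1 - d) hsym (fun v α => ?_) u p ?_
  · have h1 := hcls v α
    have h2 := hdv v
    omega
  · have h1 := hcls u 0
    have h2 := hdv u
    omega
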